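/- arXiv:2403.14519 — 7 statements merged into one kernel-verified Lean document; each statement's English description precedes it below -/
import Mathlib

section
/- Let V : ℝ → ℝ be a differentiable function, let c_l ≥ 0 and δ_l < 0 be real constants, and suppose that for every t ≥ 0 with V(t) ≥ 0 one has V'(t) ≤ δ_l − c_l · V(t). If V(0) ≥ 0, then there exists a time t* with 0 ≤ t* ≤ V(0)/(−δ_l) such that V(t*) = 0. (In particular, under the robust CLF constraint with strictly negative slack δ_l, every trajectory reaches the exit face, where the Lyapunov function vanishes, in finite time bounded by V(0)/(−δ_l).) -/
/-- Proposition 3 (finite exit time): if `V` is differentiable, `c_l ≥ 0`, `δ_l < 0`,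
and the CLF constraint `V' t ≤ δ_l - c_l * V t` holds whenever `t ≥ 0` and `V t ≥ 0`,
then starting from `V 0 ≥ 0` the function `V` vanishes at some time
`t* ∈ [0, V 0 / (-δ_l)]`. -/
theorem clf_finite_exit_time (V : ℝ → ℝ) (c_l δ_l : ℝ)
    (hV : Differentiable ℝ V) (hc : 0 ≤ c_l) (hδ : δ_l < 0)
    (hclf : ∀ t : ℝ, 0 ≤ t → 0 ≤ V t → deriv V t ≤ δ_l - c_l * V t)
    (h0 : 0 ≤ V 0) :
    ∃ tstar : ℝ, 0 ≤ tstar ∧ tstar ≤ V 0 / (-δ_l) ∧ V tstar = 0 := by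
  by_contra! hne
  set T := V 0 / (-δ_l) with hT
  have hT0 : 0 ≤ T := div_nonneg h0 (by linarith)
  have hpos : ∀ t ∈ Set.Icc 0 T, 0 < V t := by
    intro t ht
    by_contra! hle
    obtain ⟨s, hs, hs0⟩ :=
      intermediate_value_Icc' ht.1 hV.continuous.continuousOn ⟨hle, h0⟩
    exact hne s hs.1 (hs.2.trans ht.2) hs0
  have hderiv : ∀ t ∈ interior (Set.Icc 0 T), deriv V t ≤ δ_l := by
    intro t ht
    have ht' := interior_subset ht
    have hVt := (hpos t ht').le
    linarith [hclf t ht'.1 hVt, mul_nonneg hc hVt]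
  have hdecay := (convex_Icc 0 T).image_sub_le_mul_sub_of_deriv_le
    hV.continuous.continuousOn hV.differentiableOn hderiv
    0 (Set.left_mem_Icc.2 hT0) T (Set.right_mem_Icc.2 hT0) hT0
  have hTV : δ_l * T = -V 0 := by
    rw [hT]
    field_simp [hδ.ne]
  have hVT := hpos T (Set.right_mem_Icc.2 hT0)
  linarith
end

section
/- Let A_x be an m × n real matrix, b ∈ ℝ^m, A_K an n × n real matrix, and δ < 0. Suppose the polytope X = {x ∈ ℝⁿ : A_x x ≤ b} is bounded, contains 0, and for every x₀ ∈ X and every row index i with (A_x x₀)ᵢ = bᵢ one has (A_x (A_K x₀))ᵢ ≤ δ. Then every eigenvalue μ ∈ ℂ of A_K (viewed as a complex matrix via the embedding ℝ → ℂ) has strictly negative real part. -/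
open Matrix

/-- A real matrix commutes with taking the real part of a complex multiple of a vector. -/
theorem mulVec_re_mul {m n : ℕ} (B : Matrix (Fin m) (Fin n) ℝ) (z : ℂ) (v : Fin n → ℂ) :
    B.mulVec (fun k => (z * v k).re) =
      fun i => (z * (B.map (Complex.ofReal ·)).mulVec v i).re := by
  ext i
  simp only [Matrix.mulVec, dotProduct, Matrix.map_apply, Finset.mul_sum, Complex.re_sum]
  refine Finset.sum_congr rfl fun k _ => ?_
  rw [mul_left_comm, Complex.re_ofReal_mul]

/-- If a set of real vectors containing the real parts of all complex multiples of `v` is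
bounded, then `v = 0`. -/
theorem eq_zero_of_isBounded_re_mul {n : ℕ} {s : Set (Fin n → ℝ)} (hs : Bornology.IsBounded s)
    {v : Fin n → ℂ} (hv : ∀ z : ℂ, (fun k => (z * v k).re) ∈ s) : v = 0 := by
  obtain ⟨R, hR⟩ := hs.exists_norm_le
  ext k
  by_contra hk
  have h := (norm_le_pi_norm _ k).trans (hR _ (hv (((R + 1 : ℝ) : ℂ) / v k)))
  rw [div_mul_cancel₀ _ hk, Complex.ofReal_re, Real.norm_eq_abs] at h
  linarith [le_abs_self (R + 1)]

/-- Spectral form of Proposition 5: under the inward-pointing condition with strictly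
negative margin on a bounded polytope containing `0`, every (complex) eigenvalue of
`A_K` has strictly negative real part. -/
theorem inwardPointing_eigenvalues_neg_re {m n : ℕ} (Ax : Matrix (Fin m) (Fin n) ℝ)
    (b : Fin m → ℝ) (AK : Matrix (Fin n) (Fin n) ℝ) (δ : ℝ) (hδ : δ < 0)
    (hbounded : Bornology.IsBounded {x : Fin n → ℝ | ∀ i, Ax.mulVec x i ≤ b i})
    (h0 : (0 : Fin n → ℝ) ∈ {x : Fin n → ℝ | ∀ i, Ax.mulVec x i ≤ b i})
    (hinward : ∀ x₀ : Fin n → ℝ, (∀ i, Ax.mulVec x₀ i ≤ b i) →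
      ∀ i, Ax.mulVec x₀ i = b i → Ax.mulVec (AK.mulVec x₀) i ≤ δ) :
    ∀ μ : ℂ, (∃ v : Fin n → ℂ, v ≠ 0 ∧ (AK.map (Complex.ofReal ·)).mulVec v = μ • v) →
      μ.re < 0 := by
  rintro μ ⟨v, hv0, hv⟩
  have hb : ∀ i, 0 < b i := by
    intro i
    have hi : 0 ≤ b i := by simpa using h0 i
    refine hi.lt_of_ne fun h => ?_
    have := hinward 0 h0 i (by simpa using h)
    simp only [Matrix.mulVec_zero, Pi.zero_apply] at this
    linarith
  set c : Fin m → ℂ := (Ax.map (Complex.ofReal ·)).mulVec v with hc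
  obtain ⟨j₀, hj₀⟩ : ∃ j, c j ≠ 0 := by
    by_contra! h
    refine hv0 (eq_zero_of_isBounded_re_mul hbounded fun z i => ?_)
    rw [mulVec_re_mul, ← hc]
    simpa [h i] using (hb i).le
  obtain ⟨i, -, hmax⟩ := Finset.exists_max_image Finset.univ (fun j => ‖c j‖ / b j)
    ⟨j₀, Finset.mem_univ _⟩
  have hci : 0 < ‖c i‖ := by
    have h1 := hmax j₀ (Finset.mem_univ _)
    have h2 : 0 < ‖c j₀‖ / b j₀ := div_pos (norm_pos_iff.2 hj₀) (hb j₀)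
    exact (div_pos_iff_of_pos_right (hb i)).1 (h2.trans_le h1)
  have hci0 : c i ≠ 0 := norm_pos_iff.1 hci
  set z : ℂ := (b i : ℂ) / c i with hz
  have hzi : z * c i = b i := div_mul_cancel₀ _ hci0
  have hA := mulVec_re_mul AK z v
  have key := hinward (fun k => (z * v k).re) (fun j => ?_) i ?_
  · have hAx := mulVec_re_mul Ax (z * μ) v
    have hx : (fun k => (z * (AK.map (Complex.ofReal ·)).mulVec v k).re) =
        fun k => (z * μ * v k).re := by
      simp [hv, mul_assoc]
    rw [hA, hx, hAx, ← hc] at key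
    simp only at key
    rw [mul_right_comm, hzi, Complex.re_ofReal_mul] at key
    exact (pos_iff_neg_of_mul_neg (key.trans_lt hδ)).1 (hb i)
  · rw [mulVec_re_mul, ← hc]
    refine (Complex.re_le_norm _).trans ?_
    have h := hmax j (Finset.mem_univ _)
    rw [div_le_div_iff₀ (hb j) (hb i)] at h
    rw [norm_mul, hz, norm_div, Complex.norm_real, Real.norm_of_nonneg (hb i).le,
      div_mul_eq_mul_div, div_le_iff₀ hci]
    linarith
  · rw [mulVec_re_mul, ← hc]
    simp only
    rw [hzi, Complex.ofReal_re]
end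

section
/- Let A_x be an m × n real matrix, b ∈ ℝ^m, A_K an n × n real matrix, and δ < 0. Suppose the polytope X = {x ∈ ℝⁿ : A_x x ≤ b} is bounded, has 0 in its interior, and for every x₀ ∈ X and every row index i with (A_x x₀)ᵢ = bᵢ one has (A_x (A_K x₀))ᵢ ≤ δ. Then the matrix A_K is invertible. -/
open Matrix

/-- A line through the origin meets the boundary of a bounded polyhedron containing `0`:
some point of the line lies in the polyhedron and makes one of its constraints active. -/
lemma exists_smul_active_of_isBounded {ι κ : Type*} [Fintype ι] [Fintype κ]
    (A : Matrix ι κ ℝ) (b : ι → ℝ)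
    (hbounded : Bornology.IsBounded {x : κ → ℝ | ∀ i, A.mulVec x i ≤ b i})
    (h0 : (0 : κ → ℝ) ∈ {x : κ → ℝ | ∀ i, A.mulVec x i ≤ b i})
    {v : κ → ℝ} (hv : v ≠ 0) :
    ∃ t : ℝ, (∀ i, A.mulVec (t • v) i ≤ b i) ∧ ∃ i, A.mulVec (t • v) i = b i := by
  by_contra! hne
  have hcont (i : ι) : Continuous fun t : ℝ => A.mulVec (t • v) i := by
    simp only [Matrix.mulVec_smul]
    fun_prop
  have hclosed : IsClosed {t : ℝ | ∀ i, A.mulVec (t • v) i ≤ b i} := by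
    simp only [Set.ofPred_forall]
    exact isClosed_iInter fun i => isClosed_le (hcont i) continuous_const
  have hopen : IsOpen {t : ℝ | ∀ i, A.mulVec (t • v) i ≤ b i} := by
    have hstrict : {t : ℝ | ∀ i, A.mulVec (t • v) i ≤ b i} =
        {t : ℝ | ∀ i, A.mulVec (t • v) i < b i} :=
      Set.Subset.antisymm (fun t ht i => lt_of_le_of_ne (ht i) (hne t ht i))
        fun t ht i => (ht i).le
    rw [hstrict]
    simp only [Set.ofPred_forall]
    exact isOpen_iInter_of_finite fun i => isOpen_lt (hcont i) continuous_const
  have huniv : {t : ℝ | ∀ i, A.mulVec (t • v) i ≤ b i} = Set.univ :=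
    IsClopen.eq_univ ⟨hclosed, hopen⟩ ⟨0, by simpa using h0⟩
  obtain ⟨C, hC⟩ := hbounded.exists_norm_le
  have hvpos : 0 < ‖v‖ := norm_pos_iff.2 hv
  have hmem : (C + 1) / ‖v‖ ∈ {t : ℝ | ∀ i, A.mulVec (t • v) i ≤ b i} :=
    huniv ▸ Set.mem_univ _
  have hle := hC _ hmem
  rw [norm_smul, norm_div, norm_norm, div_mul_cancel₀ _ hvpos.ne', Real.norm_eq_abs] at hle
  linarith [le_abs_self (C + 1)]

/-- Exclusion of the singular case in Proposition 5: if the bounded polytope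
`X = {x | A_x x ≤ b}` has `0` in its interior and the field `x ↦ A_K x` is
inward-pointing on `X` with a strictly negative margin, then `A_K` is invertible. -/
theorem inwardPointing_invertible {m n : ℕ} (Ax : Matrix (Fin m) (Fin n) ℝ)
    (b : Fin m → ℝ) (AK : Matrix (Fin n) (Fin n) ℝ) (δ : ℝ) (hδ : δ < 0)
    (hbounded : Bornology.IsBounded {x : Fin n → ℝ | ∀ i, Ax.mulVec x i ≤ b i})
    (h0 : (0 : Fin n → ℝ) ∈ interior {x : Fin n → ℝ | ∀ i, Ax.mulVec x i ≤ b i})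
    (hinward : ∀ x₀ : Fin n → ℝ, (∀ i, Ax.mulVec x₀ i ≤ b i) →
      ∀ i, Ax.mulVec x₀ i = b i → Ax.mulVec (AK.mulVec x₀) i ≤ δ) :
    IsUnit AK := by
  by_contra hAK
  have hdet : AK.det = 0 := by
    by_contra h
    exact hAK ((Matrix.isUnit_iff_isUnit_det AK).2 (isUnit_iff_ne_zero.2 h))
  obtain ⟨v, hv, hAKv⟩ := Matrix.exists_mulVec_eq_zero_iff.2 hdet
  obtain ⟨t, ht, i, hi⟩ := exists_smul_active_of_isBounded Ax b hbounded
    (interior_subset h0) hv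
  have h := hinward (t • v) ht i hi
  rw [Matrix.mulVec_smul, hAKv, smul_zero, Matrix.mulVec_zero] at h
  exact absurd h (not_le.2 hδ)
end

section
/- Let A be an n × n real matrix, let x_e, z ∈ ℝⁿ, let A_h be an m × n real matrix, let r ≥ 1 be a natural number, and let α₁, …, α_{r−1} be real numbers. Assume the cone condition: for every v ∈ ℝⁿ, if A_h v ≥ 0 componentwise and ⟨z, v⟩ ≤ 0, then v = 0. Assume further that for every j with 1 ≤ j ≤ r: (i) ⟨z, A^j x_e⟩ + Σ_{i=1}^{j−1} αᵢ ⟨z, A^i x_e⟩ ≤ 0, and (ii) A_h (A^j x_e + Σ_{i=1}^{j−1} αᵢ A^i x_e) ≥ 0 componentwise. Then A^j x_e = 0 for every j with 1 ≤ j ≤ r. -/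
open Matrix Finset

/-- Inductive core of Proposition 1 (stabilization to a vertex). Under the proper
cone condition on `A_h` and `z`, the higher-order CLF conditions (i) and CBF
conditions (ii) at the vertex `x_e` force `A^j x_e = 0` for all `1 ≤ j ≤ r`. -/
theorem vertex_stabilization {m n : ℕ} (A : Matrix (Fin n) (Fin n) ℝ)
    (x_e z : Fin n → ℝ) (Ah : Matrix (Fin m) (Fin n) ℝ) (r : ℕ) (hr : 1 ≤ r)
    (α : ℕ → ℝ)
    (hcone : ∀ v : Fin n → ℝ, (∀ i, 0 ≤ Ah.mulVec v i) → z ⬝ᵥ v ≤ 0 → v = 0)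
    (hclf : ∀ j, 1 ≤ j → j ≤ r →
      z ⬝ᵥ (A ^ j).mulVec x_e + ∑ i ∈ Finset.Ico 1 j, α i * (z ⬝ᵥ (A ^ i).mulVec x_e) ≤ 0)
    (hcbf : ∀ j, 1 ≤ j → j ≤ r → ∀ k,
      0 ≤ Ah.mulVec ((A ^ j).mulVec x_e + ∑ i ∈ Finset.Ico 1 j, α i • (A ^ i).mulVec x_e) k) :
    ∀ j, 1 ≤ j → j ≤ r → (A ^ j).mulVec x_e = 0 := by
  intro j
  induction j using Nat.strong_induction_on with
  | _ j ih =>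
    intro h1 hj
    have hprev : ∀ i ∈ Finset.Ico 1 j, (A ^ i).mulVec x_e = 0 := fun i hi => by
      obtain ⟨hi1, hij⟩ := Finset.mem_Ico.mp hi
      exact ih i hij hi1 (hij.le.trans hj)
    have hV : ∑ i ∈ Finset.Ico 1 j, α i * (z ⬝ᵥ (A ^ i).mulVec x_e) = 0 :=
      Finset.sum_eq_zero fun i hi => by rw [hprev i hi, dotProduct_zero, mul_zero]
    have hh : ∑ i ∈ Finset.Ico 1 j, α i • (A ^ i).mulVec x_e = 0 :=
      Finset.sum_eq_zero fun i hi => by rw [hprev i hi, smul_zero]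
    have hclf_j := hclf j h1 hj
    have hcbf_j := hcbf j h1 hj
    rw [hV, add_zero] at hclf_j
    rw [hh, add_zero] at hcbf_j
    exact hcone _ hcbf_j hclf_j
end

section
/- Work in ℝ². Let x, l_f, l_i ∈ ℝ² with l_f ≠ x and l_i ≠ x, and suppose the vectors l_i − x and l_f − x are linearly independent. Let d = ‖l_f − x‖ and set l̃_f = x + d⁻¹ • (l_f − x). Suppose l̃_i ∈ ℝ² satisfies both: (a) l̃_i = x + t • (l_i − x) for some real t, and (b) l̃_i = l̃_f + s' • (l_i − l_f) for some real s'. Then t = d⁻¹, and consequently l_i − x = d • (l̃_i − x). -/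
open Matrix

/-- Lemma 4 (rescaling bearing measurements) in `ℝ²`: if `l̃_i` lies both on the
line through `x` with direction `l_i − x` and on the line through
`l̃_f = x + ‖l_f − x‖⁻¹ • (l_f − x)` with direction `l_i − l_f`, then the scale
along the bearing is `‖l_f − x‖⁻¹`, and hence `l_i − x = ‖l_f − x‖ • (l̃_i − x)`. -/
theorem bearing_rescaling (x l_f l_i : EuclideanSpace ℝ (Fin 2))
    (hf : l_f ≠ x) (hi : l_i ≠ x)
    (hindep : LinearIndependent ℝ ![l_i - x, l_f - x])
    (d : ℝ) (hd : d = ‖l_f - x‖)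
    (ltf : EuclideanSpace ℝ (Fin 2)) (hltf : ltf = x + d⁻¹ • (l_f - x))
    (lti : EuclideanSpace ℝ (Fin 2)) (t s' : ℝ)
    (ha : lti = x + t • (l_i - x))
    (hb : lti = ltf + s' • (l_i - l_f)) :
    t = d⁻¹ ∧ l_i - x = d • (lti - x) := by
  have hd0 : d ≠ 0 := hd ▸ norm_ne_zero_iff.mpr (sub_ne_zero.mpr hf)
  have hcomb : (t - s') • (l_i - x) + (s' - d⁻¹) • (l_f - x) = 0 := by
    have h : x + t • (l_i - x) = x + d⁻¹ • (l_f - x) + s' • (l_i - l_f) := by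
      rw [← ha, hb, hltf]
    rw [← sub_eq_zero] at h
    rw [← h]
    module
  obtain ⟨hts, hsd⟩ := LinearIndependent.pair_iff.mp hindep _ _ hcomb
  have ht : t = d⁻¹ := (sub_eq_zero.mp hts).trans (sub_eq_zero.mp hsd)
  refine ⟨ht, ?_⟩
  rw [ha, ht, add_sub_cancel_left, smul_inv_smul₀ hd0]
end

section
/- Let a, h, s, s_min, s_max, c ∈ ℝ with 0 < s_min, s_min ≤ s ≤ s_max, c > 0, and h ≥ 0. (CBF part) If a + c·h ≥ 0 then s⁻¹·a + (c/s_min)·h ≥ 0. (CLF part) If instead a + c·h ≤ 0 then s⁻¹·a + (c/s_max)·h ≤ 0. -/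
/-- Proposition 8 (modified CBF/CLF conditions under rescaling): for
`0 < s_min ≤ s ≤ s_max`, `c > 0` and `h ≥ 0`,
(CBF) `a + c·h ≥ 0` implies `s⁻¹·a + (c/s_min)·h ≥ 0`, and
(CLF) `a + c·h ≤ 0` implies `s⁻¹·a + (c/s_max)·h ≤ 0`. -/
theorem rescaled_cbf_clf (a h s s_min s_max c : ℝ)
    (hmin : 0 < s_min) (h1 : s_min ≤ s) (h2 : s ≤ s_max)
    (hc : 0 < c) (hh : 0 ≤ h) :
    (0 ≤ a + c * h → 0 ≤ s⁻¹ * a + (c / s_min) * h) ∧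
    (a + c * h ≤ 0 → s⁻¹ * a + (c / s_max) * h ≤ 0) := by
  have hs : 0 < s := hmin.trans_le h1
  have key : s⁻¹ * (a + c * h) = s⁻¹ * a + c / s * h := by ring
  constructor
  · intro ha
    calc 0 ≤ s⁻¹ * (a + c * h) := mul_nonneg (inv_pos.2 hs).le ha
      _ = s⁻¹ * a + c / s * h := key
      _ ≤ s⁻¹ * a + c / s_min * h := by gcongr
  · intro ha
    calc s⁻¹ * a + c / s_max * h ≤ s⁻¹ * a + c / s * h := by gcongr
      _ = s⁻¹ * (a + c * h) := key.symm
      _ ≤ 0 := mul_nonpos_of_nonneg_of_nonpos (inv_pos.2 hs).le ha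
end

section
/- Let A_x be an m × n real matrix, b ∈ ℝ^m with bᵢ > 0 for every i, and let A_K be an n × n real matrix. Suppose there exists a nonzero v ∈ ℝⁿ with A_K v = 0. If the polytope X = {x ∈ ℝⁿ : A_x x ≤ b} is bounded, then there exist a scalar τ > 0 and a row index i such that x₀ := τ • v satisfies A_x x₀ ≤ b componentwise, (A_x x₀)ᵢ = bᵢ, and (A_x (A_K x₀))ᵢ = 0; in particular, for any δ < 0, the field x ↦ A_K x is not inward-pointing with margin δ on X. -/
open Matrix

/-- A direction along which no row of `A` increases is a recession direction of
`{x | A x ≤ b}`, so a bounded polyhedron containing the origin admits no nonzero one. -/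
theorem exists_mulVec_pos_of_isBounded {m n : ℕ} (A : Matrix (Fin m) (Fin n) ℝ)
    (b : Fin m → ℝ) (hb : ∀ i, 0 ≤ b i) (v : Fin n → ℝ) (hv : v ≠ 0)
    (hbounded : Bornology.IsBounded {x : Fin n → ℝ | ∀ i, A.mulVec x i ≤ b i}) :
    ∃ i, 0 < A.mulVec v i := by
  by_contra! h
  obtain ⟨R, hR⟩ := hbounded.exists_norm_le
  have hv' : 0 < ‖v‖ := norm_pos_iff.mpr hv
  have hτ : 0 ≤ (|R| + 1) / ‖v‖ := by positivity
  have hmem := hR (((|R| + 1) / ‖v‖) • v) fun i => by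
    rw [Matrix.mulVec_smul, Pi.smul_apply, smul_eq_mul]
    exact (mul_nonpos_of_nonneg_of_nonpos hτ (h i)).trans (hb i)
  rw [norm_smul, Real.norm_of_nonneg hτ, div_mul_cancel₀ _ hv'.ne'] at hmem
  linarith [le_abs_self R]

/-- The ray through `v` leaves a bounded polyhedron with the origin in its interior
through a point at which some constraint is active. -/
theorem exists_smul_active {m n : ℕ} (A : Matrix (Fin m) (Fin n) ℝ)
    (b : Fin m → ℝ) (hb : ∀ i, 0 < b i) (v : Fin n → ℝ) (hv : v ≠ 0)
    (hbounded : Bornology.IsBounded {x : Fin n → ℝ | ∀ i, A.mulVec x i ≤ b i}) :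
    ∃ τ : ℝ, 0 < τ ∧ ∃ i, (∀ j, A.mulVec (τ • v) j ≤ b j) ∧ A.mulVec (τ • v) i = b i := by
  obtain ⟨k, hk⟩ := exists_mulVec_pos_of_isBounded A b (fun i => (hb i).le) v hv hbounded
  obtain ⟨i, hi, hmin⟩ := (Finset.univ.filter fun j => 0 < A.mulVec v j).exists_min_image
    (fun j => b j / A.mulVec v j) ⟨k, by simpa using hk⟩
  simp only [Finset.mem_filter, Finset.mem_univ, true_and] at hi hmin
  have hτ : 0 < b i / A.mulVec v i := div_pos (hb i) hi
  refine ⟨b i / A.mulVec v i, hτ, i, fun j => ?_, ?_⟩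
  · rw [Matrix.mulVec_smul, Pi.smul_apply, smul_eq_mul]
    rcases lt_or_ge 0 (A.mulVec v j) with hj | hj
    · exact (le_div_iff₀ hj).mp (hmin j hj)
    · exact (mul_nonpos_of_nonneg_of_nonpos hτ.le hj).trans (hb j).le
  · rw [Matrix.mulVec_smul, Pi.smul_apply, smul_eq_mul, div_mul_cancel₀ _ hi.ne']

/-- Case 2 in the proof of Proposition 5: if `A_K` has a nonzero kernel vector `v`,
the polytope `X = {x | A_x x ≤ b}` is bounded and `b > 0` componentwise, then some
positive multiple `x₀ = τ • v` lies in `X` with an active constraint `i` at which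
the field value row vanishes; in particular the field `x ↦ A_K x` is not
inward-pointing with any strictly negative margin `δ` on `X`. -/
theorem singular_not_inwardPointing {m n : ℕ} (Ax : Matrix (Fin m) (Fin n) ℝ)
    (b : Fin m → ℝ) (AK : Matrix (Fin n) (Fin n) ℝ)
    (hb : ∀ i, 0 < b i)
    (v : Fin n → ℝ) (hv : v ≠ 0) (hker : AK.mulVec v = 0)
    (hbounded : Bornology.IsBounded {x : Fin n → ℝ | ∀ i, Ax.mulVec x i ≤ b i}) :
    (∃ τ : ℝ, 0 < τ ∧ ∃ i : Fin m,
        (∀ j, Ax.mulVec (τ • v) j ≤ b j) ∧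
        Ax.mulVec (τ • v) i = b i ∧
        Ax.mulVec (AK.mulVec (τ • v)) i = 0) ∧
      ∀ δ : ℝ, δ < 0 →
        ¬ (∀ x₀ : Fin n → ℝ, (∀ j, Ax.mulVec x₀ j ≤ b j) →
            ∀ j, Ax.mulVec x₀ j = b j → Ax.mulVec (AK.mulVec x₀) j ≤ δ) := by
  obtain ⟨τ, hτ, i, hmem, hact⟩ := exists_smul_active Ax b hb v hv hbounded
  have hzero : Ax.mulVec (AK.mulVec (τ • v)) i = 0 := by
    rw [Matrix.mulVec_smul, hker, smul_zero, Matrix.mulVec_zero, Pi.zero_apply]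
  refine ⟨⟨τ, hτ, i, hmem, hact, hzero⟩, fun δ hδ h => ?_⟩
  exact (h _ hmem i hact).not_gt (hzero ▸ hδ)
end
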